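/- arXiv:1601.02430 — 5 statements merged into one kernel-verified Lean document; each statement's English description precedes it below -/
import Mathlib

section
/- For every t ∈ [t_n, t_{n+1}]: (i) Û(t) = Uⁿ + (1/2)·(t − t_n)·L(U(t) + Uⁿ); (ii) Û has derivative L(U(t)) at every t ∈ (t_n, t_{n+1}); and (iii) Û(t_n) = Uⁿ and Û(t_{n+1}) = U^{n+1}. -/
open scoped Topology

/-- The trapezoidal rule is exact for affine functions with values in a Banach space. -/
theorem integral_affine_eq_trapezoid {E : Type*} [NormedAddCommGroup E] [NormedSpace ℝ E]
    [CompleteSpace E] (a t : ℝ) (x y : E) :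
    ∫ s in a..t, (x + (s - a) • y) = ((1 / 2) * (t - a)) • ((x + (t - a) • y) + x) := by
  have hderiv : ∀ s ∈ Set.uIcc a t,
      HasDerivAt (fun s : ℝ => (s - a) • x + ((s - a) ^ 2 / 2) • y) (x + (s - a) • y) s := by
    intro s _
    have h₁ : HasDerivAt (fun s : ℝ => s - a) 1 s := (hasDerivAt_id s).sub_const a
    have h₂ : HasDerivAt (fun s : ℝ => (s - a) ^ 2 / 2) (s - a) s := by
      refine ((h₁.pow 2).div_const 2).congr_deriv ?_
      simp
    exact ((h₁.smul_const x).add (h₂.smul_const y)).congr_deriv (by rw [one_smul])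
  rw [intervalIntegral.integral_eq_sub_of_hasDerivAt hderiv
    (Continuous.intervalIntegrable (by fun_prop) a t)]
  module

/-- Proposition 2.1 of the paper (properties of the time reconstruction `Û`):
with `L` continuous linear, `(U¹ - U⁰)/k = L((U⁰ + U¹)/2)`,
`U(t)` the linear interpolant and `Û(t) = U⁰ + ∫_{tₙ}^t L(U(s)) ds`, one has
(i) `Û(t) = U⁰ + (1/2)(t - tₙ) L(U(t) + U⁰)` on `[tₙ, tₙ₊₁]`,
(ii) `Û' = L(U(t))` on `(tₙ, tₙ₊₁)`, and
(iii) `Û(tₙ) = U⁰`, `Û(tₙ₊₁) = U¹`. -/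
theorem time_reconstruction_properties {X : Type*} [NormedAddCommGroup X]
    [NormedSpace ℂ X] [CompleteSpace X] (L : X →L[ℂ] X)
    (tn tn1 : ℝ) (h : tn < tn1) (U0 U1 : X)
    (hscheme : (tn1 - tn)⁻¹ • (U1 - U0) = L ((2 : ℝ)⁻¹ • (U0 + U1)))
    (U : ℝ → X)
    (hU : ∀ t, U t = ((tn1 - t) / (tn1 - tn)) • U0 + ((t - tn) / (tn1 - tn)) • U1)
    (Uhat : ℝ → X)
    (hUhat : ∀ t, Uhat t = U0 + ∫ s in tn..t, L (U s)) :
    (∀ t ∈ Set.Icc tn tn1, Uhat t = U0 + ((1 / 2) * (t - tn)) • L (U t + U0)) ∧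
    (∀ t ∈ Set.Ioo tn tn1, HasDerivAt Uhat (L (U t)) t) ∧
    Uhat tn = U0 ∧ Uhat tn1 = U1 := by
  have hk : tn1 - tn ≠ 0 := (sub_pos.mpr h).ne'
  have hL (r : ℝ) (x : X) : L (r • x) = r • L x := map_smul (L.restrictScalars ℝ) r x
  have hLU (t : ℝ) : L (U t) = L U0 + (t - tn) • ((tn1 - tn)⁻¹ • (L U1 - L U0)) := by
    have hcoeff : (tn1 - t) / (tn1 - tn) = 1 - (t - tn) / (tn1 - tn) := by
      field_simp
      ring
    rw [hU, map_add, hL, hL, hcoeff, div_eq_mul_inv]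
    module
  have hformula (t : ℝ) : Uhat t = U0 + ((1 / 2) * (t - tn)) • L (U t + U0) := by
    rw [hUhat, map_add]
    simp only [hLU]
    rw [integral_affine_eq_trapezoid]
  have hcont : Continuous fun s => L (U s) := by
    simp only [hLU]
    fun_prop
  refine ⟨fun t _ => hformula t, fun t _ => ?_, by simp [hUhat], ?_⟩
  · rw [funext hUhat]
    exact (hcont.integral_hasStrictDerivAt tn t).hasDerivAt.const_add U0
  · have hU1 : U tn1 = U1 := by simp [hU, hk]
    have hstep : U1 - U0 = (tn1 - tn) • L ((2 : ℝ)⁻¹ • (U0 + U1)) := by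
      rw [← hscheme, smul_inv_smul₀ hk]
    rw [hformula, hU1, ← eq_sub_iff_add_eq', hstep, hL, add_comm U1 U0]
    module
end

section
/- For every t ∈ [t_n, t_{n+1}], the difference between the reconstruction and the interpolant satisfies Û(t) − U(t) = −(1/2)·(t − t_n)·(t_{n+1} − t)·L((U^{n+1} − Uⁿ)/k). -/
theorem integral_linearInterpolation {X : Type*} [NormedAddCommGroup X] [NormedSpace ℝ X]
    [CompleteSpace X] (a b t : ℝ) (x y : X) :
    ∫ s in a..t, (((b - s) / (b - a)) • x + ((s - a) / (b - a)) • y)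
      = (((b - a) ^ 2 - (b - t) ^ 2) / (2 * (b - a))) • x
        + ((t - a) ^ 2 / (2 * (b - a))) • y := by
  have hx : IntervalIntegrable (fun s : ℝ => ((b - s) / (b - a)) • x) MeasureTheory.volume a t :=
    Continuous.intervalIntegrable (by fun_prop) a t
  have hy : IntervalIntegrable (fun s : ℝ => ((s - a) / (b - a)) • y) MeasureTheory.volume a t :=
    Continuous.intervalIntegrable (by fun_prop) a t
  rw [intervalIntegral.integral_add hx hy, intervalIntegral.integral_smul_const,
    intervalIntegral.integral_smul_const, intervalIntegral.integral_div,
    intervalIntegral.integral_div]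
  simp only [intervalIntegral.integral_comp_sub_left (fun s : ℝ => s),
    intervalIntegral.integral_comp_sub_right (fun s : ℝ => s), integral_id, div_mul_eq_div_div]
  congr 2 <;> ring

/-- Proposition 2.2 of the paper (formula (2.16)): with `L` continuous linear,
`(U¹ - U⁰)/k = L((U⁰ + U¹)/2)`, `U(t)` the linear interpolant and
`Û(t) = U⁰ + ∫_{tₙ}^t L(U(s)) ds`, the difference `Û - U` satisfies
`Û(t) - U(t) = -(1/2)(t - tₙ)(tₙ₊₁ - t) L((U¹ - U⁰)/k)` on `[tₙ, tₙ₊₁]`. -/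
theorem time_reconstruction_minus_interpolant {X : Type*} [NormedAddCommGroup X]
    [NormedSpace ℂ X] [CompleteSpace X] (L : X →L[ℂ] X)
    (tn tn1 : ℝ) (h : tn < tn1) (U0 U1 : X)
    (hscheme : (tn1 - tn)⁻¹ • (U1 - U0) = L ((2 : ℝ)⁻¹ • (U0 + U1)))
    (U : ℝ → X)
    (hU : ∀ t, U t = ((tn1 - t) / (tn1 - tn)) • U0 + ((t - tn) / (tn1 - tn)) • U1)
    (Uhat : ℝ → X)
    (hUhat : ∀ t, Uhat t = U0 + ∫ s in tn..t, L (U s)) :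
    ∀ t ∈ Set.Icc tn tn1,
      Uhat t - U t
        = (-(1 / 2) * (t - tn) * (tn1 - t)) • L ((tn1 - tn)⁻¹ • (U1 - U0)) := by
  intro t _
  have hk : tn1 - tn ≠ 0 := (sub_pos.mpr h).ne'
  have hLU (s : ℝ) : L (U s)
      = ((tn1 - s) / (tn1 - tn)) • L U0 + ((s - tn) / (tn1 - tn)) • L U1 := by
    rw [hU, map_add, L.map_smul_of_tower, L.map_smul_of_tower]
  have hU1 : U1 = U0 + ((tn1 - tn) / 2) • (L U0 + L U1) := by
    rw [L.map_smul_of_tower, map_add, inv_smul_eq_iff₀ hk, smul_smul, sub_eq_iff_eq_add'] at hscheme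
    rwa [div_eq_mul_inv]
  rw [hUhat, hU, L.map_smul_of_tower, map_sub]
  simp only [hLU, integral_linearInterpolation]
  generalize L U0 = A at *
  generalize L U1 = B at *
  rw [hU1]
  match_scalars <;> field_simp <;> ring
end

section
/- The time–space reconstruction Û satisfies: (i) Û(t_n) = R(Uⁿ); (ii) Û(t_{n+1}) = R′(U^{n+1}); and (iii) for every t ∈ (t_n, t_{n+1}), Û has derivative at t equal to R′(W(t)) + (1/k)·(R′(P(Uⁿ)) − R(Uⁿ)). -/
/-- The midpoint rule is exact for affine functions. -/
theorem intervalIntegral_midpoint_affine {X : Type*} [NormedAddCommGroup X] [NormedSpace ℝ X]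
    [CompleteSpace X] (a b : ℝ) (c v : X) :
    ∫ s in a..b, (c + (s - (a + b) / 2) • v) = (b - a) • c := by
  have hid : ∫ s in a..b, (s - (a + b) / 2) = 0 := by
    rw [intervalIntegral.integral_sub (by simp) (by simp), integral_id,
      intervalIntegral.integral_const, smul_eq_mul]
    ring
  rw [intervalIntegral.integral_add (by simp)
      (Continuous.intervalIntegrable (by fun_prop) _ _),
    intervalIntegral.integral_const, intervalIntegral.integral_smul_const, hid, zero_smul,
    add_zero]


/-- Proposition 4.1 of the paper (properties of the time–space reconstruction `Û`,
equation (4.18)): with `R`, `R′`, `P` continuous linear, `W` affine on `[tₙ, tₙ₊₁]`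
(`W(t) = W(t_{n+1/2}) + (t - t_{n+1/2}) • W₁`), the scheme relation
`U¹ - P(U⁰) = k • W(t_{n+1/2})`, and
`Û(t) = R(U⁰) + ((t - tₙ)/k) • (R′(P(U⁰)) - R(U⁰)) + ∫_{tₙ}^t R′(W(s)) ds`, one has
(i) `Û(tₙ) = R(U⁰)`, (ii) `Û(tₙ₊₁) = R′(U¹)`, and
(iii) `Û' (t) = R′(W(t)) + (1/k)(R′(P(U⁰)) - R(U⁰))` for `t ∈ (tₙ, tₙ₊₁)`. -/
theorem time_space_reconstruction_properties {X : Type*} [NormedAddCommGroup X]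
    [NormedSpace ℂ X] [CompleteSpace X] (R R' P : X →L[ℂ] X)
    (tn tn1 : ℝ) (h : tn < tn1) (U0 U1 : X) (W : ℝ → X) (W1 : X)
    (hW : ∀ t, W t = W ((tn + tn1) / 2) + (t - (tn + tn1) / 2) • W1)
    (hscheme : U1 - P U0 = (tn1 - tn) • W ((tn + tn1) / 2))
    (Uhat : ℝ → X)
    (hUhat : ∀ t, Uhat t = R U0 + ((t - tn) / (tn1 - tn)) • (R' (P U0) - R U0)
      + ∫ s in tn..t, R' (W s)) :
    Uhat tn = R U0 ∧ Uhat tn1 = R' U1 ∧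
    ∀ t ∈ Set.Ioo tn tn1,
      HasDerivAt Uhat (R' (W t) + (tn1 - tn)⁻¹ • (R' (P U0) - R U0)) t := by
  have hk : tn1 - tn ≠ 0 := sub_ne_zero.mpr h.ne'
  have hWc : Continuous W := by
    rw [show W = fun t => _ from funext hW]
    fun_prop
  have hint : Continuous fun s => R' (W s) := R'.continuous.comp hWc
  refine ⟨by simp [hUhat], ?_, fun t _ => ?_⟩
  · have hI : ∫ s in tn..tn1, R' (W s) = R' U1 - R' (P U0) := by
      rw [← map_sub, hscheme, R'.map_smul_of_tower,
        ← intervalIntegral_midpoint_affine tn tn1 (R' (W ((tn + tn1) / 2))) (R' W1)]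
      refine intervalIntegral.integral_congr fun s _ => ?_
      rw [hW s, map_add, R'.map_smul_of_tower]
    rw [hUhat, hI, div_self hk, one_smul]
    abel
  · rw [show Uhat = fun t => _ from funext hUhat]
    have hlin : HasDerivAt (fun t => (t - tn) / (tn1 - tn)) (tn1 - tn)⁻¹ t := by
      simpa using ((hasDerivAt_id t).sub_const tn).div_const (tn1 - tn)
    have hFTC : HasDerivAt (fun t => ∫ s in tn..t, R' (W s)) (R' (W t)) t :=
      hint.integral_hasStrictDerivAt tn t |>.hasDerivAt
    rw [add_comm (R' (W t))]
    exact ((hlin.smul_const _).const_add _).add hFTC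
end

section
/- Define ω(t) := ℓ₀(t) • R(Uⁿ) + ℓ₁(t) • R′(U^{n+1}), where ℓ₀(t) := (t_{n+1} − t)/k and ℓ₁(t) := (t − t_n)/k. Then sup over t ∈ [t_n, t_{n+1}] of ‖Û(t) − ω(t)‖ is at most (k²/8) · ‖R′(W₁)‖. -/
/-- The integral of an affine vector-valued function. -/
theorem intervalIntegral_add_sub_smul {E : Type*} [NormedAddCommGroup E] [NormedSpace ℝ E]
    [CompleteSpace E] (a b m : ℝ) (v w : E) :
    ∫ s in a..b, (v + (s - m) • w) =
      (b - a) • v + ((b - a) * (a + b - 2 * m) / 2) • w := by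
  have hinteg : IntervalIntegrable (fun s : ℝ => (s - m) • w) MeasureTheory.volume a b :=
    Continuous.intervalIntegrable (by fun_prop) a b
  have hlin : ∫ s in a..b, (s - m) = (b - a) * (a + b - 2 * m) / 2 := by
    rw [intervalIntegral.integral_sub (Continuous.intervalIntegrable (by fun_prop) a b)
      (Continuous.intervalIntegrable (by fun_prop) a b), integral_id,
      intervalIntegral.integral_const, smul_eq_mul]
    ring
  rw [intervalIntegral.integral_add intervalIntegrable_const hinteg,
    intervalIntegral.integral_const, intervalIntegral.integral_smul_const, hlin]

/-- The core bound of Proposition 5.1 of the paper: with `R`, `R′`, `P` continuous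
linear, `W` affine on `[tₙ, tₙ₊₁]` (`W(t) = W(t_{n+1/2}) + (t - t_{n+1/2}) • W₁`), the
scheme relation `U¹ - P(U⁰) = k • W(t_{n+1/2})`, the time–space reconstruction
`Û(t) = R(U⁰) + ((t - tₙ)/k) • (R′(P(U⁰)) - R(U⁰)) + ∫_{tₙ}^t R′(W(s)) ds`, and the
interpolant `ω(t) = ℓ₀(t) • R(U⁰) + ℓ₁(t) • R′(U¹)`, the time-reconstruction error
`σ = Û - ω` satisfies `sup_{t ∈ [tₙ, tₙ₊₁]} ‖Û(t) - ω(t)‖ ≤ (k²/8) ‖R′(W₁)‖`. -/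
theorem time_space_reconstruction_error_bound {X : Type*} [NormedAddCommGroup X]
    [NormedSpace ℂ X] [CompleteSpace X] (R R' P : X →L[ℂ] X)
    (tn tn1 : ℝ) (h : tn < tn1) (U0 U1 : X) (W : ℝ → X) (W1 : X)
    (hW : ∀ t, W t = W ((tn + tn1) / 2) + (t - (tn + tn1) / 2) • W1)
    (hscheme : U1 - P U0 = (tn1 - tn) • W ((tn + tn1) / 2))
    (Uhat : ℝ → X)
    (hUhat : ∀ t, Uhat t = R U0 + ((t - tn) / (tn1 - tn)) • (R' (P U0) - R U0)
      + ∫ s in tn..t, R' (W s))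
    (ω : ℝ → X)
    (hω : ∀ t, ω t = ((tn1 - t) / (tn1 - tn)) • R U0 + ((t - tn) / (tn1 - tn)) • R' U1) :
    ∀ t ∈ Set.Icc tn tn1,
      ‖Uhat t - ω t‖ ≤ (tn1 - tn) ^ 2 / 8 * ‖R' W1‖ := by
  intro t ht
  have hk : tn1 - tn ≠ 0 := (sub_pos.2 h).ne'
  have hRW : ∀ s, R' (W s) =
      R' (W ((tn + tn1) / 2)) + (s - (tn + tn1) / 2) • R' W1 := fun s => by
    rw [hW s, map_add, ContinuousLinearMap.map_smul_of_tower]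
  have hU1 : R' U1 = R' (P U0) + (tn1 - tn) • R' (W ((tn + tn1) / 2)) := by
    rw [← ContinuousLinearMap.map_smul_of_tower, ← hscheme, map_sub, add_sub_cancel]
  have hinteg : ∫ s in tn..t, R' (W s) = (t - tn) • R' (W ((tn + tn1) / 2)) +
      ((t - tn) * (tn + t - 2 * ((tn + tn1) / 2)) / 2) • R' W1 := by
    rw [← intervalIntegral_add_sub_smul]
    exact intervalIntegral.integral_congr fun s _ => hRW s
  have herr : Uhat t - ω t = (-((t - tn) * (tn1 - t) / 2)) • R' W1 := by
    rw [hUhat, hω, hinteg, hU1]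
    match_scalars <;> field_simp <;> ring
  rw [herr, norm_smul, Real.norm_eq_abs, abs_neg,
    abs_of_nonneg (by nlinarith [mul_nonneg (sub_nonneg.2 ht.1) (sub_nonneg.2 ht.2)])]
  refine mul_le_mul_of_nonneg_right ?_ (norm_nonneg _)
  nlinarith [sq_nonneg (2 * t - tn - tn1)]
end

section
/- Let D : X → X be an additional continuous ℂ-linear map and α a real number, and define, for t ∈ [t_n, t_{n+1}], R₁(t) := (W(t) − R′(W(t))) − (1/k) • (R′(P(Uⁿ)) − R(Uⁿ)) + (i·α·ℓ₀(t)) • (D(Uⁿ) − P(D(Uⁿ))), where ℓ₀(t) := (t_{n+1} − t)/k. Then for every t ∈ [t_n, t_{n+1}], R₁(t) = (t − t_{n+1/2}) • (W₁ − R′(W₁)) − (1/k) • ((R′(U^{n+1}) − U^{n+1}) − (R(Uⁿ) − Uⁿ)) + (v(t) − P(v(t))), where v(t) := (i·α·ℓ₀(t)) • D(Uⁿ) + (1/k) • Uⁿ. -/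
/-- Lemma 5.1 of the paper (the rewriting (5.11) = (5.14) of the residual `R₁`): with
`R`, `R′`, `P`, `D` continuous linear, `W` affine on `[tₙ, tₙ₊₁]`
(`W(t) = W(t_{n+1/2}) + (t - t_{n+1/2}) • W₁`), the scheme relation
`U¹ - P(U⁰) = k • W(t_{n+1/2})`, `ℓ₀(t) = (tₙ₊₁ - t)/k`, and
`R₁(t) = (W(t) - R′(W(t))) - (1/k) • (R′(P(U⁰)) - R(U⁰)) + (i α ℓ₀(t)) • (D(U⁰) - P(D(U⁰)))`,
one has on `[tₙ, tₙ₊₁]`: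
`R₁(t) = (t - t_{n+1/2}) • (W₁ - R′(W₁)) - (1/k) • ((R′(U¹) - U¹) - (R(U⁰) - U⁰))
        + (v(t) - P(v(t)))` with `v(t) = (i α ℓ₀(t)) • D(U⁰) + (1/k) • U⁰`. -/
theorem residual_R1_rewriting {X : Type*} [NormedAddCommGroup X]
    [NormedSpace ℂ X] [CompleteSpace X] (R R' P D : X →L[ℂ] X) (α : ℝ)
    (tn tn1 : ℝ) (h : tn < tn1) (U0 U1 : X) (W : ℝ → X) (W1 : X)
    (hW : ∀ t, W t = W ((tn + tn1) / 2) + (t - (tn + tn1) / 2) • W1)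
    (hscheme : U1 - P U0 = (tn1 - tn) • W ((tn + tn1) / 2))
    (R₁ : ℝ → X)
    (hR₁ : ∀ t, R₁ t = (W t - R' (W t)) - (tn1 - tn)⁻¹ • (R' (P U0) - R U0)
      + (Complex.I * (α : ℂ) * (((tn1 - t) / (tn1 - tn) : ℝ) : ℂ)) • (D U0 - P (D U0)))
    (v : ℝ → X)
    (hv : ∀ t, v t = (Complex.I * (α : ℂ) * (((tn1 - t) / (tn1 - tn) : ℝ) : ℂ)) • D U0
      + (tn1 - tn)⁻¹ • U0) :
    ∀ t ∈ Set.Icc tn tn1,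
      R₁ t = (t - (tn + tn1) / 2) • (W1 - R' W1)
        - (tn1 - tn)⁻¹ • ((R' U1 - U1) - (R U0 - U0))
        + (v t - P (v t)) := by
  intro t _
  have hk : tn1 - tn ≠ 0 := sub_ne_zero.mpr h.ne'
  have hmid : W ((tn + tn1) / 2) = (tn1 - tn)⁻¹ • (U1 - P U0) := by
    rw [hscheme, inv_smul_smul₀ hk]
  rw [hR₁, hv, hW t, hmid]
  simp only [map_add, map_sub, map_smul, ContinuousLinearMap.map_smul_of_tower, smul_sub]
  abel
end
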